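/- (High Order CBF forward invariance with general class-K functions, stated along a trajectory.) Let m ≥ 1 and let α₁, …, α_m : ℝ → ℝ each be locally Lipschitz, strictly increasing, with αᵢ(0) = 0 (extended class-K functions). Let φ₀ : ℝ → ℝ be m times differentiable on [0, ∞), and define recursively φᵢ(t) = φᵢ₋₁'(t) + αᵢ(φᵢ₋₁(t)) for i = 1, …, m, assuming each φᵢ for i < m is differentiable on [0, ∞). If φ_m(t) ≥ 0 for all t ≥ 0 and φᵢ(0) ≥ 0 for every i = 0, …, m−1, then φᵢ(t) ≥ 0 for every i = 0, …, m−1 and every t ≥ 0; in particular φ₀(t) ≥ 0 for all t ≥ 0. -/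

import Mathlib

theorem hocbf_step (a : ℝ → ℝ) (ha : StrictMono a) (ha0 : a 0 = 0) (f f' : ℝ → ℝ)
    (hd : ∀ t ∈ Set.Ici (0 : ℝ), HasDerivWithinAt f (f' t) (Set.Ici (0 : ℝ)) t)
    (hp : ∀ t ∈ Set.Ici (0 : ℝ), 0 ≤ f' t + a (f t)) (h0 : 0 ≤ f 0) :
    ∀ t ∈ Set.Ici (0 : ℝ), 0 ≤ f t := by
  intro t ht
  have ht0 : (0 : ℝ) ≤ t := ht
  refine le_of_forall_pos_le_add fun ε hε => ?_
  have key := image_le_of_deriv_right_lt_deriv_boundary' (f := fun x => -f x)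
    (f' := fun x => -f' x) (a := 0) (b := t) (B := fun _ => ε) (B' := fun _ => 0)
    (fun x hx => ((hd x hx.1).continuousWithinAt.mono Set.Icc_subset_Ici_self).neg)
    (fun x hx => ((hd x hx.1).mono (Set.Ici_subset_Ici.2 hx.1)).neg)
    (by linarith) continuousOn_const
    (fun x _ => hasDerivWithinAt_const _ _ _)
    (fun x hx he => by
      have h1 := hp x hx.1
      have h2 : f x < 0 := by linarith
      have h3 := ha h2
      linarith)
    (x := t) ⟨ht0, le_refl t⟩
  linarith

/-- High Order CBF forward invariance along a trajectory, with general extended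
class-K functions `α i` (locally Lipschitz, strictly increasing, vanishing at 0).
The functions `φ i` for `i = 0, …, m` are related by
`φ i = (φ (i-1))' + α i ∘ φ (i-1)` on `[0, ∞)` (with `φ' i` the derivative of
`φ i` within `[0, ∞)`). If `φ m ≥ 0` on `[0, ∞)` and `φ i (0) ≥ 0` for all
`i < m`, then `φ i (t) ≥ 0` for all `i < m` and all `t ≥ 0`; in particular
`φ 0`, the barrier value, stays nonnegative. -/
theorem hocbf_forward_invariance_classK (m : ℕ) (hm : 1 ≤ m)
    (α : ℕ → ℝ → ℝ)
    (hlip : ∀ i, 1 ≤ i → i ≤ m → LocallyLipschitz (α i))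
    (hmono : ∀ i, 1 ≤ i → i ≤ m → StrictMono (α i))
    (hα0 : ∀ i, 1 ≤ i → i ≤ m → α i 0 = 0)
    (φ φ' : ℕ → ℝ → ℝ)
    (hderiv : ∀ i < m, ∀ t ∈ Set.Ici (0 : ℝ),
      HasDerivWithinAt (φ i) (φ' i t) (Set.Ici (0 : ℝ)) t)
    (hrec : ∀ i, 1 ≤ i → i ≤ m → ∀ t ∈ Set.Ici (0 : ℝ),
      φ i t = φ' (i - 1) t + α i (φ (i - 1) t))
    (htop : ∀ t ∈ Set.Ici (0 : ℝ), 0 ≤ φ m t)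
    (h0 : ∀ i < m, 0 ≤ φ i 0) :
    ∀ i < m, ∀ t ∈ Set.Ici (0 : ℝ), 0 ≤ φ i t := by
  have key : ∀ k ≤ m, ∀ t ∈ Set.Ici (0 : ℝ), 0 ≤ φ (m - k) t := by
    intro k
    induction k with
    | zero => intro _; simpa using htop
    | succ k ih =>
      intro hk
      have ih' := ih (by omega)
      have e : m - k - 1 = m - (k + 1) := by omega
      refine hocbf_step (α (m - k)) (hmono _ (by omega) (by omega))
        (hα0 _ (by omega) (by omega)) _ (φ' (m - (k + 1))) (hderiv _ (by omega)) ?_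
        (h0 _ (by omega))
      intro t ht
      have h1 := ih' t ht
      rw [hrec (m - k) (by omega) (by omega) t ht, e] at h1
      exact h1
  intro i hi
  have := key (m - i) (by omega)
  rwa [show m - (m - i) = i by omega] at this
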